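/- For every ε > 0 and all t > 0, the functional F(t) := ∫₀ᴸ x (ρ v_t v_x + μ p_t p_x) dx satisfies dF/dt(t) ≤ −E(t) + (L/2)[ρ + (1+ε)ξ₁²/α₁]·|v_t(L,t)|² + (L/2)[μ + (1 + 1/ε)ξ₂²γ²/α₁ + ξ₂²/β]·|p_t(L,t)|². -/

import Mathlib

/-- Partial derivative in the first (space) variable of `f = f x t`. -/
noncomputable def pdx (f : ℝ → ℝ → ℝ) (x t : ℝ) : ℝ := deriv (fun y => f y t) x

/-- Partial derivative in the second (time) variable of `f = f x t`. -/
noncomputable def pdt (f : ℝ → ℝ → ℝ) (x t : ℝ) : ℝ := deriv (fun s => f x s) t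

lemma hasDerivAt_fst_of_contDiff {f : ℝ → ℝ → ℝ} (hf : ContDiff ℝ 1 (Function.uncurry f))
    (x t : ℝ) : HasDerivAt (fun y => f y t) (fderiv ℝ (Function.uncurry f) (x, t) (1, 0)) x :=
  ((hf.differentiable one_ne_zero (x, t)).hasFDerivAt.comp_hasDerivAt x
    ((hasDerivAt_id x).prodMk (hasDerivAt_const x t)) :)

lemma hasDerivAt_snd_of_contDiff {f : ℝ → ℝ → ℝ} (hf : ContDiff ℝ 1 (Function.uncurry f))
    (x t : ℝ) : HasDerivAt (fun s => f x s) (fderiv ℝ (Function.uncurry f) (x, t) (0, 1)) t :=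
  ((hf.differentiable one_ne_zero (x, t)).hasFDerivAt.comp_hasDerivAt t
    ((hasDerivAt_const t x).prodMk (hasDerivAt_id t)) :)

lemma pdx_eq_fderiv {f : ℝ → ℝ → ℝ} (hf : ContDiff ℝ 1 (Function.uncurry f)) (x t : ℝ) :
    pdx f x t = fderiv ℝ (Function.uncurry f) (x, t) (1, 0) :=
  (hasDerivAt_fst_of_contDiff hf x t).deriv

lemma pdt_eq_fderiv {f : ℝ → ℝ → ℝ} (hf : ContDiff ℝ 1 (Function.uncurry f)) (x t : ℝ) :
    pdt f x t = fderiv ℝ (Function.uncurry f) (x, t) (0, 1) :=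
  (hasDerivAt_snd_of_contDiff hf x t).deriv

lemma hasDerivAt_pdx {f : ℝ → ℝ → ℝ} (hf : ContDiff ℝ 1 (Function.uncurry f)) (x t : ℝ) :
    HasDerivAt (fun y => f y t) (pdx f x t) x :=
  (hasDerivAt_fst_of_contDiff hf x t).differentiableAt.hasDerivAt

lemma hasDerivAt_pdt {f : ℝ → ℝ → ℝ} (hf : ContDiff ℝ 1 (Function.uncurry f)) (x t : ℝ) :
    HasDerivAt (fun s => f x s) (pdt f x t) t :=
  (hasDerivAt_snd_of_contDiff hf x t).differentiableAt.hasDerivAt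

lemma uncurry_pdx {f : ℝ → ℝ → ℝ} (hf : ContDiff ℝ 1 (Function.uncurry f)) :
    Function.uncurry (pdx f) = fun z => fderiv ℝ (Function.uncurry f) z (1, 0) :=
  funext fun z => pdx_eq_fderiv hf z.1 z.2

lemma uncurry_pdt {f : ℝ → ℝ → ℝ} (hf : ContDiff ℝ 1 (Function.uncurry f)) :
    Function.uncurry (pdt f) = fun z => fderiv ℝ (Function.uncurry f) z (0, 1) :=
  funext fun z => pdt_eq_fderiv hf z.1 z.2

lemma contDiff_pdx {f : ℝ → ℝ → ℝ} (hf : ContDiff ℝ 2 (Function.uncurry f)) :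
    ContDiff ℝ 1 (Function.uncurry (pdx f)) := by
  rw [uncurry_pdx (hf.of_le one_le_two)]
  exact (hf.fderiv_right (m := 1) (by norm_num)).clm_apply contDiff_const

lemma contDiff_pdt {f : ℝ → ℝ → ℝ} (hf : ContDiff ℝ 2 (Function.uncurry f)) :
    ContDiff ℝ 1 (Function.uncurry (pdt f)) := by
  rw [uncurry_pdt (hf.of_le one_le_two)]
  exact (hf.fderiv_right (m := 1) (by norm_num)).clm_apply contDiff_const

lemma continuous_pdx {f : ℝ → ℝ → ℝ} (hf : ContDiff ℝ 1 (Function.uncurry f)) :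
    Continuous (Function.uncurry (pdx f)) := by
  rw [uncurry_pdx hf]
  exact (hf.continuous_fderiv one_ne_zero).clm_apply continuous_const

lemma continuous_pdt {f : ℝ → ℝ → ℝ} (hf : ContDiff ℝ 1 (Function.uncurry f)) :
    Continuous (Function.uncurry (pdt f)) := by
  rw [uncurry_pdt hf]
  exact (hf.continuous_fderiv one_ne_zero).clm_apply continuous_const

lemma pdt_pdx_eq_pdx_pdt {f : ℝ → ℝ → ℝ} (hf : ContDiff ℝ 2 (Function.uncurry f)) (x t : ℝ) :
    pdt (pdx f) x t = pdx (pdt f) x t := by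
  have h1 : ContDiff ℝ 1 (Function.uncurry f) := hf.of_le one_le_two
  have hd : HasFDerivAt (fderiv ℝ (Function.uncurry f))
      (fderiv ℝ (fderiv ℝ (Function.uncurry f)) (x, t)) (x, t) :=
    ((hf.fderiv_right (m := 1) (by norm_num)).differentiable one_ne_zero (x, t)).hasFDerivAt
  have hsymm : IsSymmSndFDerivAt ℝ (Function.uncurry f) (x, t) :=
    hf.contDiffAt.isSymmSndFDerivAt (by simp)
  rw [pdt_eq_fderiv (contDiff_pdx hf), pdx_eq_fderiv (contDiff_pdt hf), uncurry_pdx h1,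
    uncurry_pdt h1, (hd.clm_apply (hasFDerivAt_const _ _)).fderiv,
    (hd.clm_apply (hasFDerivAt_const _ _)).fderiv]
  simpa using hsymm (0, 1) (1, 0)

/-- Differentiation under the integral sign for a continuously differentiable integrand. -/
lemma hasDerivAt_integral_of_contDiff {G : ℝ → ℝ → ℝ} (hG : ContDiff ℝ 1 (Function.uncurry G))
    (a b t : ℝ) :
    HasDerivAt (fun s => ∫ x in a..b, G x s) (∫ x in a..b, pdt G x t) t := by
  have hc : Continuous (Function.uncurry (pdt G)) := continuous_pdt hG
  obtain ⟨C, hC⟩ := (isCompact_uIcc.prod (isCompact_closedBall t 1)).exists_bound_of_continuousOn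
    (s := Set.uIcc a b ×ˢ Metric.closedBall t 1) hc.continuousOn
  have hGs : ∀ s, Continuous fun x => G x s := fun s =>
    hG.continuous.comp (Continuous.prodMk_left s)
  refine (intervalIntegral.hasDerivAt_integral_of_dominated_loc_of_deriv_le
    (F := fun s x => G x s) (F' := fun s x => pdt G x s) (bound := fun _ => C)
    (Metric.closedBall_mem_nhds t one_pos) (.of_forall fun s => (hGs s).aestronglyMeasurable)
    ((hGs t).intervalIntegrable a b)
    (hc.comp (Continuous.prodMk_left t)).aestronglyMeasurable
    (.of_forall fun x hx s hs => ?_) intervalIntegrable_const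
    (.of_forall fun x _ s _ => hasDerivAt_pdt hG x s)).2
  exact hC (x, s) ⟨Set.uIoc_subset_uIcc hx, hs⟩

/-- Young's inequality for the boundary values `a = v_x` and `b = p_x`, expressed through the
boundary velocities `V` and `P`. -/
lemma boundary_energy_le {β α₁ γ ξ₁ ξ₂ ε a b V P : ℝ} (hβ : 0 < β) (hα₁ : 0 < α₁) (hε : 0 < ε)
    (h1 : (α₁ + γ ^ 2 * β) * a - γ * β * b = -ξ₁ * V)
    (h2 : -(γ * β) * a + β * b = -ξ₂ * P) :
    α₁ * a ^ 2 + β * (γ * a - b) ^ 2 ≤ (1 + ε) * ξ₁ ^ 2 / α₁ * V ^ 2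
      + ((1 + 1 / ε) * ξ₂ ^ 2 * γ ^ 2 / α₁ + ξ₂ ^ 2 / β) * P ^ 2 := by
  have ha : a = -(ξ₁ * V + γ * (ξ₂ * P)) / α₁ := by
    rw [eq_div_iff hα₁.ne']
    linear_combination h1 + γ * h2
  have hb : γ * a - b = ξ₂ * P / β := by
    rw [eq_div_iff hβ.ne']
    linear_combination -h2
  rw [hb, ha]
  have key : (1 + ε) * ξ₁ ^ 2 / α₁ * V ^ 2
      + ((1 + 1 / ε) * ξ₂ ^ 2 * γ ^ 2 / α₁ + ξ₂ ^ 2 / β) * P ^ 2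
      - (α₁ * (-(ξ₁ * V + γ * (ξ₂ * P)) / α₁) ^ 2 + β * (ξ₂ * P / β) ^ 2)
      = (ε * (ξ₁ * V) - γ * (ξ₂ * P)) ^ 2 / (ε * α₁) := by
    field_simp
    ring
  have : 0 ≤ (ε * (ξ₁ * V) - γ * (ξ₂ * P)) ^ 2 / (ε * α₁) := by positivity
  linarith

/-- For every `ε > 0` and all `t > 0`,
`dF/dt ≤ −E + (L/2)[ρ + (1+ε)ξ₁²/α₁]|v_t(L,t)|² + (L/2)[μ + (1+1/ε)ξ₂²γ²/α₁ + ξ₂²/β]|p_t(L,t)|²`. -/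
theorem F_derivative_estimate
    (ρ β μ α₁ L γ : ℝ) (hρ : 0 < ρ) (hβ : 0 < β) (hμ : 0 < μ) (hα₁ : 0 < α₁) (hL : 0 < L)
    (α : ℝ) (hα : α = α₁ + γ ^ 2 * β)
    (η : ℝ)
    (hη : η = max (Real.sqrt (ρ / α₁) + Real.sqrt (μ * γ ^ 2 / α₁))
                  (Real.sqrt (μ / β) + Real.sqrt (μ * γ ^ 2 / α₁)))
    (ξ₁ ξ₂ : ℝ) (hξ₁ : 0 < ξ₁) (hξ₂ : 0 < ξ₂)
    (v p : ℝ → ℝ → ℝ)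
    (hv : ContDiff ℝ 2 (Function.uncurry v)) (hp : ContDiff ℝ 2 (Function.uncurry p))
    (heq1 : ∀ x ∈ Set.Ioo (0:ℝ) L, ∀ t > (0:ℝ),
      ρ * pdt (pdt v) x t = α * pdx (pdx v) x t - γ * β * pdx (pdx p) x t)
    (heq2 : ∀ x ∈ Set.Ioo (0:ℝ) L, ∀ t > (0:ℝ),
      μ * pdt (pdt p) x t = -(γ * β) * pdx (pdx v) x t + β * pdx (pdx p) x t)
    (hbc0 : ∀ t > (0:ℝ), v 0 t = 0 ∧ p 0 t = 0)
    (hbc1 : ∀ t > (0:ℝ), α * pdx v L t - γ * β * pdx p L t = -ξ₁ * pdt v L t)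
    (hbc2 : ∀ t > (0:ℝ), -(γ * β) * pdx v L t + β * pdx p L t = -ξ₂ * pdt p L t)
    (E : ℝ → ℝ)
    (hE : ∀ t, E t = (1 / 2) * ∫ x in (0:ℝ)..L,
        ρ * (pdt v x t) ^ 2 + μ * (pdt p x t) ^ 2 + α₁ * (pdx v x t) ^ 2
          + β * (γ * pdx v x t - pdx p x t) ^ 2)
    (F : ℝ → ℝ)
    (hF : ∀ t, F t = ∫ x in (0:ℝ)..L,
        x * (ρ * pdt v x t * pdx v x t + μ * pdt p x t * pdx p x t))
    : ∀ ε > (0:ℝ), ∀ t > (0:ℝ),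
      deriv F t ≤ -E t + (L / 2) * (ρ + (1 + ε) * ξ₁ ^ 2 / α₁) * |pdt v L t| ^ 2
        + (L / 2) * (μ + (1 + 1 / ε) * ξ₂ ^ 2 * γ ^ 2 / α₁ + ξ₂ ^ 2 / β) * |pdt p L t| ^ 2 := by
  subst hα
  intro ε hε t ht
  have hvx := contDiff_pdx hv
  have hvt := contDiff_pdt hv
  have hpx := contDiff_pdx hp
  have hpt := contDiff_pdt hp
  set e : ℝ → ℝ := fun x => ρ * (pdt v x t) ^ 2 + μ * (pdt p x t) ^ 2 + α₁ * (pdx v x t) ^ 2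
    + β * (γ * pdx v x t - pdx p x t) ^ 2 with he
  set e' : ℝ → ℝ := fun x => ρ * (2 * pdt v x t * pdx (pdt v) x t)
    + μ * (2 * pdt p x t * pdx (pdt p) x t) + α₁ * (2 * pdx v x t * pdx (pdx v) x t)
    + β * (2 * (γ * pdx v x t - pdx p x t) * (γ * pdx (pdx v) x t - pdx (pdx p) x t)) with he'
  have hslice : ∀ {f : ℝ → ℝ → ℝ}, Continuous (Function.uncurry f) → Continuous fun x => f x t :=
    fun hf => hf.comp (Continuous.prodMk_left t)
  have c1 := hslice hvx.continuous
  have c2 := hslice hvt.continuous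
  have c3 := hslice hpx.continuous
  have c4 := hslice hpt.continuous
  have c5 := hslice (continuous_pdx hvx)
  have c6 := hslice (continuous_pdx hvt)
  have c7 := hslice (continuous_pdx hpx)
  have c8 := hslice (continuous_pdx hpt)
  have hec : Continuous e := by fun_prop
  have hec' : Continuous e' := by fun_prop
  have hed : ∀ x, HasDerivAt e (e' x) x := fun x => by
    have d1 := hasDerivAt_pdx hvx x t
    have d2 := hasDerivAt_pdx hvt x t
    have d3 := hasDerivAt_pdx hpx x t
    have d4 := hasDerivAt_pdx hpt x t
    refine (((((d2.pow 2).const_mul ρ).add ((d4.pow 2).const_mul μ)).add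
      ((d1.pow 2).const_mul α₁)).add ((((d1.const_mul γ).sub d3).pow 2).const_mul β)).congr_deriv ?_
    simp [he']
  have hparts : ∫ x in (0:ℝ)..L, (e x / 2 + x / 2 * e' x) = L / 2 * e L := by
    rw [intervalIntegral.integral_eq_sub_of_hasDerivAt (f := fun x => x / 2 * e x)]
    · simp
    · intro x _
      refine (((hasDerivAt_id x).div_const 2).mul (hed x)).congr_deriv ?_
      simp
      ring
    · exact Continuous.intervalIntegrable (by fun_prop) _ _
  set G : ℝ → ℝ → ℝ := fun x s =>
    x * (ρ * pdt v x s * pdx v x s + μ * pdt p x s * pdx p x s) with hGdef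
  have hG : ContDiff ℝ 1 (Function.uncurry G) :=
    contDiff_fst.mul (((contDiff_const.mul hvt).mul hvx).add ((contDiff_const.mul hpt).mul hpx))
  have hGt : ∀ x, pdt G x t = x * (ρ * (pdt (pdt v) x t * pdx v x t + pdt v x t * pdx (pdt v) x t)
      + μ * (pdt (pdt p) x t * pdx p x t + pdt p x t * pdx (pdt p) x t)) := fun x => by
    have d1 := hasDerivAt_pdt hvx x t
    have d2 := hasDerivAt_pdt hvt x t
    have d3 := hasDerivAt_pdt hpx x t
    have d4 := hasDerivAt_pdt hpt x t
    rw [pdt_pdx_eq_pdx_pdt hv] at d1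
    rw [pdt_pdx_eq_pdx_pdt hp] at d3
    refine ((((((d2.const_mul ρ).mul d1).add ((d4.const_mul μ).mul d3)).const_mul x).congr_deriv
      ?_ :)).deriv
    ring
  have hFd : deriv F t = ∫ x in (0:ℝ)..L, pdt G x t := by
    rw [funext hF]
    exact (hasDerivAt_integral_of_contDiff hG 0 L t).deriv
  have hF' : deriv F t = L / 2 * e L - E t := by
    rw [hFd, hE, ← hparts, ← intervalIntegral.integral_const_mul,
      ← intervalIntegral.integral_sub (Continuous.intervalIntegrable (by fun_prop) _ _)
        ((hec.const_mul (1 / 2)).intervalIntegrable _ _)]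
    refine intervalIntegral.integral_congr_Ioo_of_le hL.le fun x hx => ?_
    have q1 := heq1 x hx t ht
    have q2 := heq2 x hx t ht
    simp only [hGt, he, he']
    linear_combination x * pdx v x t * q1 + x * pdx p x t * q2
  have hB := boundary_energy_le hβ hα₁ hε (hbc1 t ht) (hbc2 t ht)
  rw [hF', sq_abs, sq_abs]
  simp only [he]
  linear_combination L / 2 * hB
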